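/- Let 1 < p < 2 < q < ∞ with 1/q = 1/p - 1/2. Then there exists a constant C > 0 such that for every w̃ ∈ L^p(ℝ²), the Biot–Savart velocity field v(x) = (1/2π)∫_{ℝ²} ((x-y)^⊥/|x-y|²) w̃(y) dy is defined for a.e. x and satisfies ‖v‖_{L^q(ℝ²)} ≤ C ‖w̃‖_{L^p(ℝ²)}. -/

import Mathlib

open MeasureTheory Real ENNReal

noncomputable section

abbrev E2 := EuclideanSpace ℝ (Fin 2)

/-- `x^⊥ = (-x₂, x₁)`. -/
def perp (x : E2) : E2 := (WithLp.equiv 2 (Fin 2 → ℝ)).symm ![-x 1, x 0]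

/-- The Biot–Savart velocity field of a scalar function `w` on `ℝ²`:
`v(x) = (1/2π) ∫ ((x-y)^⊥/|x-y|²) w(y) dy`. -/
def biotSavart (w : E2 → ℝ) (x : E2) : E2 :=
  ∫ y, ((2 * π * ‖x - y‖ ^ 2)⁻¹ * w y) • perp (x - y)

open Set

theorem measureReal_unit_ball_pos : 0 < volume.real (Metric.ball (0 : E2) 1) :=
  ENNReal.toReal_pos (Metric.measure_ball_pos _ _ one_pos).ne' measure_ball_lt_top.ne

theorem lintegral_ofReal_fun_norm {h : ℝ → ℝ} (h0 : ∀ r, 0 ≤ r → 0 ≤ h r)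
    (hi : IntegrableOn (fun r => r * h r) (Ioi 0)) :
    ∫⁻ x : E2, ENNReal.ofReal (h ‖x‖) =
      ENNReal.ofReal (2 * volume.real (Metric.ball (0 : E2) 1) * ∫ r in Ioi 0, r * h r) := by
  have hint : Integrable (fun x : E2 => h ‖x‖) :=
    (integrable_fun_norm_addHaar volume).2 (by simpa using hi)
  rw [← ofReal_integral_eq_lintegral_ofReal hint (.of_forall fun x => h0 _ (norm_nonneg x)),
    integral_fun_norm_addHaar]
  simp [mul_assoc]

theorem lintegral_near {R : ℝ} (hR : 0 < R) :
    ∫⁻ x : E2, ENNReal.ofReal ((Iio R).indicator (fun r => r⁻¹) ‖x‖) =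
      ENNReal.ofReal (2 * volume.real (Metric.ball (0 : E2) 1) * R) := by
  have key : EqOn (fun r : ℝ => r * (Iio R).indicator (fun r => r⁻¹) r)
      ((Iio R).indicator fun _ => 1) (Ioi 0) := by
    intro r (hr : 0 < r)
    by_cases h : r < R <;> simp [h, hr.ne']
  rw [lintegral_ofReal_fun_norm, setIntegral_congr_fun measurableSet_Ioi key]
  · rw [setIntegral_indicator measurableSet_Iio]
    simp [hR.le, Ioi_inter_Iio]
  · intro r hr
    exact indicator_apply_nonneg fun _ => inv_nonneg.2 hr
  · rw [integrableOn_congr_fun key measurableSet_Ioi]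
    rw [IntegrableOn, integrable_indicator_iff measurableSet_Iio, IntegrableOn,
      Measure.restrict_restrict measurableSet_Iio]
    simp [Iio_inter_Ioi]

theorem lintegral_far {R s : ℝ} (hR : 0 < R) (hs : 2 < s) :
    ∫⁻ x : E2, ENNReal.ofReal ((Ici R).indicator (fun r => r⁻¹) ‖x‖) ^ s =
      ENNReal.ofReal (2 * volume.real (Metric.ball (0 : E2) 1) / (s - 2) * R ^ (2 - s)) := by
  have key : EqOn (fun r : ℝ => r * (Ici R).indicator (fun r => r⁻¹) r ^ s)
      ((Ici R).indicator fun r => r ^ (1 - s)) (Ioi 0) := by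
    intro r (hr : 0 < r)
    by_cases h : R ≤ r
    · simp [h, Real.rpow_sub hr, Real.inv_rpow hr.le, div_eq_mul_inv]
    · simp [h, Real.zero_rpow (by linarith : s ≠ 0)]
  have h0 : ∀ r, 0 ≤ r → 0 ≤ (Ici R).indicator (fun r : ℝ => r⁻¹) r :=
    fun r hr => indicator_apply_nonneg fun _ => inv_nonneg.2 hr
  have hI : Ioi (0 : ℝ) ∩ Ici R = Ici R :=
    inter_eq_right.2 fun r hr => hR.trans_le hr
  simp_rw [ENNReal.ofReal_rpow_of_nonneg (h0 _ (norm_nonneg _)) (by linarith : 0 ≤ s)]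
  rw [lintegral_ofReal_fun_norm (h := fun r => (Ici R).indicator (fun r : ℝ => r⁻¹) r ^ s),
    setIntegral_congr_fun measurableSet_Ioi key]
  · rw [setIntegral_indicator measurableSet_Ici, hI, integral_Ici_eq_integral_Ioi,
      integral_Ioi_rpow_of_lt (by linarith) hR]
    congr 1
    rw [show 1 - s + 1 = -(s - 2) by ring, show 2 - s = -(s - 2) by ring]
    have : s - 2 ≠ 0 := by linarith
    field_simp
  · exact fun r hr => Real.rpow_nonneg (h0 r hr) s
  · rw [integrableOn_congr_fun key measurableSet_Ioi]
    rw [IntegrableOn, integrable_indicator_iff measurableSet_Ici, IntegrableOn,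
      Measure.restrict_restrict measurableSet_Ici, inter_comm, hI, ← IntegrableOn,
      integrableOn_Ici_iff_integrableOn_Ioi]
    exact integrableOn_Ioi_rpow_of_lt (by linarith) hR

theorem lintegral_rpow_sub_one_mul_ite {s : ℝ} (hs : 0 < s) (a : ℝ≥0∞) :
    ∫⁻ t in Ioi (0 : ℝ), ENNReal.ofReal (t ^ (s - 1)) * (if ENNReal.ofReal t < a then 1 else 0) =
      ENNReal.ofReal s⁻¹ * a ^ s := by
  have fin : ∀ b : ℝ, 0 ≤ b → ∫⁻ t in Ioo 0 b, ENNReal.ofReal (t ^ (s - 1)) =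
      ENNReal.ofReal s⁻¹ * ENNReal.ofReal b ^ s := by
    intro b hb
    rw [setLIntegral_congr Ioo_ae_eq_Ioc, ← ofReal_integral_eq_lintegral_ofReal,
      ← intervalIntegral.integral_of_le hb, integral_rpow (Or.inl (by linarith)),
      ENNReal.ofReal_rpow_of_nonneg hb hs.le, ← ENNReal.ofReal_mul (by positivity)]
    · simp [Real.zero_rpow hs.ne']; congr 1; field_simp
    · exact (intervalIntegrable_iff_integrableOn_Ioc_of_le hb).1
        (intervalIntegral.intervalIntegrable_rpow' (by linarith))
    · filter_upwards [ae_restrict_mem measurableSet_Ioc] with t ht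
      exact Real.rpow_nonneg ht.1.le _
  rcases eq_or_ne a ⊤ with rfl | ha
  · rw [ENNReal.top_rpow_of_pos hs, ENNReal.mul_top (by simpa using hs)]
    refine ENNReal.eq_top_of_forall_nnreal_le fun r => ?_
    have h1 := fin ((s * r) ^ s⁻¹) (by positivity)
    rw [ENNReal.ofReal_rpow_of_nonneg (by positivity) hs.le, Real.rpow_inv_rpow (by positivity)
      hs.ne', ← ENNReal.ofReal_mul (by positivity), inv_mul_cancel_left₀ hs.ne'] at h1
    rw [ENNReal.ofReal_coe_nnreal] at h1
    rw [← h1]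
    simpa using lintegral_mono_set (μ := volume) (f := fun t => ENNReal.ofReal (t ^ (s - 1)))
      (Ioo_subset_Ioi_self : Ioo (0 : ℝ) ((s * r) ^ s⁻¹) ⊆ Ioi 0)
  · lift a to NNReal using ha
    have := fin a a.2
    rw [ENNReal.ofReal_coe_nnreal] at this
    rw [← this, ← Ioi_inter_Iio, inter_comm, ← Measure.restrict_restrict measurableSet_Iio,
      ← lintegral_indicator measurableSet_Iio]
    refine setLIntegral_congr_fun measurableSet_Ioi fun t (ht : 0 < t) => ?_
    have : ENNReal.ofReal t < a ↔ t < a := by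
      rw [← ENNReal.ofReal_coe_nnreal, ENNReal.ofReal_lt_ofReal_iff_of_nonneg ht.le]
    by_cases h : t < a <;> simp [this, h]

/-- The Riesz potential of order one on the plane. -/
def rieszPotential (f : E2 → ℝ≥0∞) (x : E2) : ℝ≥0∞ :=
  ∫⁻ y, ENNReal.ofReal ‖x - y‖⁻¹ * f y

theorem measurable_rieszPotential {f : E2 → ℝ≥0∞} (hf : Measurable f) :
    Measurable (rieszPotential f) := by
  apply Measurable.lintegral_prod_right'
    (f := fun z : E2 × E2 => ENNReal.ofReal ‖z.1 - z.2‖⁻¹ * f z.2)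
  fun_prop

theorem lintegral_far_mul_le {p q : ℝ} (hp1 : 1 < p) (hp2 : p < 2)
    (hpq : 1 / q = 1 / p - 1 / 2) :
    ∃ B : ℝ, 0 < B ∧ ∀ f : E2 → ℝ≥0∞, Measurable f → ∫⁻ y, f y ^ p ≤ 1 → ∀ R, 0 < R → ∀ x,
      ∫⁻ y, ENNReal.ofReal ((Ici R).indicator (fun r => r⁻¹) ‖x - y‖) * f y ≤
        ENNReal.ofReal (B * R ^ (-(2 / q))) := by
  set s := p.conjExponent with hs_def
  have hconj : p.HolderConjugate s := Real.HolderConjugate.conjExponent hp1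
  have hs0 : 0 < s := hconj.symm.pos
  have hinv : p⁻¹ + s⁻¹ = 1 := hconj.inv_add_inv_eq_one
  have hs : 2 < s := by
    have : (2 : ℝ)⁻¹ < p⁻¹ := by gcongr
    exact (inv_lt_inv₀ hs0 two_pos).1 (by norm_num at this ⊢; linarith)
  have hω : 0 < volume.real (Metric.ball (0 : E2) 1) :=
    measureReal_unit_ball_pos
  have hs2 : 0 < s - 2 := by linarith
  refine ⟨(2 * volume.real (Metric.ball (0 : E2) 1) / (s - 2)) ^ (1 / s), by positivity, ?_⟩
  intro f hf hfp R hR x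
  have hk : Measurable ((Ici R).indicator fun r : ℝ => r⁻¹) :=
    measurable_inv.indicator measurableSet_Ici
  have hfar : ∫⁻ y : E2, ENNReal.ofReal ((Ici R).indicator (fun r => r⁻¹) ‖x - y‖) ^ s =
      ENNReal.ofReal (2 * volume.real (Metric.ball (0 : E2) 1) / (s - 2) * R ^ (2 - s)) := by
    rw [← lintegral_far hR hs]
    exact lintegral_sub_left_eq_self
      (fun z : E2 => ENNReal.ofReal ((Ici R).indicator (fun r => r⁻¹) ‖z‖) ^ s) x
  calc _ ≤ (∫⁻ y : E2, ENNReal.ofReal ((Ici R).indicator (fun r => r⁻¹) ‖x - y‖) ^ s) ^ (1 / s) *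
        (∫⁻ y, f y ^ p) ^ (1 / p) :=
        ENNReal.lintegral_mul_le_Lp_mul_Lq volume hconj.symm (by fun_prop) hf.aemeasurable
    _ ≤ (∫⁻ y : E2, ENNReal.ofReal ((Ici R).indicator (fun r => r⁻¹) ‖x - y‖) ^ s) ^ (1 / s) *
        1 := by
        gcongr
        exact ENNReal.rpow_le_one hfp (by positivity)
    _ = _ := by
        rw [mul_one, hfar, ENNReal.ofReal_rpow_of_nonneg (by positivity) (by positivity),
          Real.mul_rpow (by positivity) (by positivity), ← Real.rpow_mul hR.le]
        congr 3
        have h1 : (2 - s) * (1 / s) = 2 * s⁻¹ - 1 := by field_simp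
        have h2 : 2 / q = 2 * (1 / q) := by ring
        rw [h1, h2, hpq, one_div, ← hinv]
        linarith

theorem lintegral_lintegral_near_mul {f : E2 → ℝ≥0∞} (hf : Measurable f) {R : ℝ} (hR : 0 < R) :
    ∫⁻ x, ∫⁻ y, ENNReal.ofReal ((Iio R).indicator (fun r => r⁻¹) ‖x - y‖) * f y =
      ENNReal.ofReal (2 * volume.real (Metric.ball (0 : E2) 1) * R) * ∫⁻ y, f y := by
  have hk : Measurable ((Iio R).indicator fun r : ℝ => r⁻¹) :=
    measurable_inv.indicator measurableSet_Iio
  rw [lintegral_lintegral_swap (by fun_prop), ← lintegral_const_mul _ hf]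
  refine lintegral_congr fun y => ?_
  rw [lintegral_mul_const _ (by fun_prop), ← lintegral_near hR]
  congr 1
  exact lintegral_sub_right_eq_self
    (fun z : E2 => ENNReal.ofReal ((Iio R).indicator (fun r => r⁻¹) ‖z‖)) y

/-- Splitting the kernel at radius `R` and `f` at height `l`, where `R` and `l` are chosen
so that the far part and the bounded part contribute at most `3t/4`. -/
theorem mul_meas_rieszPotential_le {f : E2 → ℝ≥0∞} (hf : Measurable f) {R l t : ℝ} (hR : 0 < R)
    (ht : 0 < t) (hl : 4 * (2 * volume.real (Metric.ball (0 : E2) 1) * R) * l = t)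
    (hfar : ∀ x, ∫⁻ y, ENNReal.ofReal ((Ici R).indicator (fun r => r⁻¹) ‖x - y‖) * f y ≤
      ENNReal.ofReal (t / 2)) :
    ENNReal.ofReal l * volume {x | ENNReal.ofReal t < rieszPotential f x} ≤
      ∫⁻ y, f y * (if ENNReal.ofReal l < f y then 1 else 0) := by
  have hω : 0 < volume.real (Metric.ball (0 : E2) 1) :=
    measureReal_unit_ball_pos
  set A := 2 * volume.real (Metric.ball (0 : E2) 1) * R with hA
  have hA0 : 0 < A := by positivity
  have hl0 : 0 < l := by
    by_contra! h
    have : 4 * A * l ≤ 0 := mul_nonpos_of_nonneg_of_nonpos (by positivity) h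
    linarith
  have hkN : Measurable ((Iio R).indicator fun r : ℝ => r⁻¹) :=
    measurable_inv.indicator measurableSet_Iio
  have hkF : Measurable ((Ici R).indicator fun r : ℝ => r⁻¹) :=
    measurable_inv.indicator measurableSet_Ici
  set F : E2 → ℝ≥0∞ := fun y => f y * (if ENNReal.ofReal l < f y then 1 else 0) with hF
  have hFm : Measurable F :=
    hf.mul (Measurable.ite (measurableSet_lt measurable_const hf) measurable_const
      measurable_const)
  have hbound : ∀ x, rieszPotential f x ≤ ENNReal.ofReal (t / 2) + (ENNReal.ofReal (t / 4) +
      ∫⁻ y, ENNReal.ofReal ((Iio R).indicator (fun r => r⁻¹) ‖x - y‖) * F y) := by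
    intro x
    have hnear : ∫⁻ y, ENNReal.ofReal ((Iio R).indicator (fun r => r⁻¹) ‖x - y‖) *
        ENNReal.ofReal l = ENNReal.ofReal (t / 4) := by
      rw [lintegral_mul_const _ (by fun_prop), lintegral_sub_left_eq_self
        (fun z : E2 => ENNReal.ofReal ((Iio R).indicator (fun r => r⁻¹) ‖z‖)) x,
        lintegral_near hR, ← ENNReal.ofReal_mul hA0.le, ← hl]
      congr 1; ring
    grw [← hfar x]
    rw [← hnear, ← lintegral_add_left (by fun_prop), ← lintegral_add_left (by fun_prop)]
    refine lintegral_mono fun y => ?_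
    by_cases h : ‖x - y‖ < R
    · by_cases h' : ENNReal.ofReal l < f y
      · simp [h, hF, h']
      · simp only [mem_Iio, h, indicator_of_mem, mem_Ici, not_le.2 h, not_false_eq_true,
          indicator_of_notMem, hF, h', if_false]
        simp only [ENNReal.ofReal_zero, zero_mul, mul_zero, zero_add, add_zero]
        gcongr
        exact not_lt.1 h'
    · simp [h, not_lt.1 h]
  have hsub : {x | ENNReal.ofReal t < rieszPotential f x} ⊆ {x | ENNReal.ofReal (t / 4) ≤
      ∫⁻ y, ENNReal.ofReal ((Iio R).indicator (fun r => r⁻¹) ‖x - y‖) * F y} := by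
    intro x (hx : ENNReal.ofReal t < _)
    by_contra! h
    have h1 := hx.trans_le (hbound x)
    have h2 : ENNReal.ofReal t = ENNReal.ofReal (t / 2) + (ENNReal.ofReal (t / 4) +
        ENNReal.ofReal (t / 4)) := by
      rw [← ENNReal.ofReal_add (by positivity) (by positivity),
        ← ENNReal.ofReal_add (by positivity) (by positivity)]
      congr 1; ring
    rw [h2] at h1
    refine absurd h1 (not_lt.2 ?_)
    gcongr
    exact (not_le.1 h).le
  have hmarkov := mul_meas_ge_le_lintegral₀ (μ := volume)
    (f := fun x => ∫⁻ y, ENNReal.ofReal ((Iio R).indicator (fun r => r⁻¹) ‖x - y‖) * F y)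
    (Measurable.lintegral_prod_right' (f := fun z : E2 × E2 =>
      ENNReal.ofReal ((Iio R).indicator (fun r => r⁻¹) ‖z.1 - z.2‖) * F z.2)
      (by fun_prop)).aemeasurable (ENNReal.ofReal (t / 4))
  rw [lintegral_lintegral_near_mul hFm hR, ← hA, show t / 4 = A * l by rw [← hl]; ring,
    ENNReal.ofReal_mul hA0.le, mul_assoc,
    ENNReal.mul_le_mul_iff_right (by simpa using hA0) ENNReal.ofReal_ne_top,
    ← ENNReal.ofReal_mul hA0.le, ← show t / 4 = A * l by rw [← hl]; ring] at hmarkov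
  grw [hsub]
  exact hmarkov

theorem lintegral_rpow_eq_lintegral_meas_lt {α : Type*} [MeasurableSpace α] {μ : Measure α}
    [SFinite μ] {g : α → ℝ≥0∞} (hg : Measurable g) {q : ℝ} (hq : 0 < q) :
    ∫⁻ x, g x ^ q ∂μ = ENNReal.ofReal q *
      ∫⁻ t in Ioi (0 : ℝ), ENNReal.ofReal (t ^ (q - 1)) * μ {x | ENNReal.ofReal t < g x} := by
  have hm : MeasurableSet {z : ℝ × α | ENNReal.ofReal z.1 < g z.2} :=
    measurableSet_lt (by fun_prop) (by fun_prop)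
  have h1 : ∀ t : ℝ, ENNReal.ofReal (t ^ (q - 1)) * μ {x | ENNReal.ofReal t < g x} =
      ∫⁻ x, ENNReal.ofReal (t ^ (q - 1)) * (if ENNReal.ofReal t < g x then 1 else 0) ∂μ := by
    intro t
    have ht : MeasurableSet {x | ENNReal.ofReal t < g x} := measurableSet_lt measurable_const hg
    rw [lintegral_const_mul _ (Measurable.ite ht measurable_const measurable_const),
      ← lintegral_indicator_one ht]
    simp [indicator_apply]
  simp_rw [h1]
  rw [lintegral_lintegral_swap, ← lintegral_const_mul']
  · refine lintegral_congr fun x => ?_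
    rw [lintegral_rpow_sub_one_mul_ite hq, ← mul_assoc, ← ENNReal.ofReal_mul hq.le,
      mul_inv_cancel₀ hq.ne', ENNReal.ofReal_one, one_mul]
  · exact ENNReal.ofReal_ne_top
  · refine Measurable.aemeasurable ?_
    exact Measurable.mul (by fun_prop) (Measurable.ite hm measurable_const measurable_const)

theorem lintegral_rpow_le_of_forall_mul_meas_le {α β : Type*} [MeasurableSpace α]
    [MeasurableSpace β] {μ : Measure α} {ν : Measure β} [SFinite μ] [SFinite ν]
    {g : α → ℝ≥0∞} (hg : Measurable g) {f : β → ℝ≥0∞} (hf : Measurable f) {c k q : ℝ}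
    (hc : 0 < c) (hk : 0 < k) (hkq : k < q)
    (h : ∀ t, 0 < t → ENNReal.ofReal (c * t ^ k) * μ {x | ENNReal.ofReal t < g x} ≤
      ∫⁻ y, f y * (if ENNReal.ofReal (c * t ^ k) < f y then 1 else 0) ∂ν) :
    ∫⁻ x, g x ^ q ∂μ ≤ ENNReal.ofReal (q / (q - k) * c ^ (-(q / k))) * ∫⁻ y, f y ^ (q / k) ∂ν := by
  have hq : 0 < q := hk.trans hkq
  have hqk : 0 < q - k := sub_pos.2 hkq
  have hm : MeasurableSet {z : ℝ × β | ENNReal.ofReal (c * z.1 ^ k) < f z.2} :=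
    measurableSet_lt (by fun_prop) (by fun_prop)
  have hlt : ∀ t, 0 < t → ∀ a : ℝ≥0∞, ENNReal.ofReal (c * t ^ k) < a ↔
      ENNReal.ofReal t < (a / ENNReal.ofReal c) ^ k⁻¹ := by
    intro t ht a
    rw [ENNReal.lt_rpow_inv_iff hk, ENNReal.lt_div_iff_mul_lt (by simp [hc]) (by simp),
      ENNReal.ofReal_rpow_of_pos ht, mul_comm c, ENNReal.ofReal_mul (by positivity)]
  have hstep : ∀ t, 0 < t → ENNReal.ofReal (t ^ (q - 1)) * μ {x | ENNReal.ofReal t < g x} ≤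
      ENNReal.ofReal c⁻¹ * ∫⁻ y, f y * (ENNReal.ofReal (t ^ (q - k - 1)) *
        (if ENNReal.ofReal (c * t ^ k) < f y then 1 else 0)) ∂ν := by
    intro t ht
    have hmt : Measurable fun y => f y * (if ENNReal.ofReal (c * t ^ k) < f y then 1 else 0) :=
      hf.mul (Measurable.ite (measurableSet_lt measurable_const hf) measurable_const
        measurable_const)
    simp_rw [mul_left_comm (f _)]
    rw [lintegral_const_mul _ hmt]
    grw [← h t ht]
    rw [← mul_assoc, ← mul_assoc, ← ENNReal.ofReal_mul (by positivity),
      ← ENNReal.ofReal_mul (by positivity)]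
    refine le_of_eq ?_
    congr 2
    rw [show q - 1 = (q - k - 1) + k by ring, Real.rpow_add ht]
    field_simp
  have hinner : ∀ a : ℝ≥0∞, ∫⁻ t in Ioi (0 : ℝ), a * (ENNReal.ofReal (t ^ (q - k - 1)) *
      (if ENNReal.ofReal (c * t ^ k) < a then 1 else 0)) =
      ENNReal.ofReal (q - k)⁻¹ * ENNReal.ofReal (c ^ (-(q / k - 1))) * a ^ (q / k) := by
    intro a
    have hmt : Measurable fun t : ℝ => ENNReal.ofReal (t ^ (q - k - 1)) *
        (if ENNReal.ofReal (c * t ^ k) < a then (1 : ℝ≥0∞) else 0) :=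
      Measurable.mul (by fun_prop) (Measurable.ite
        (measurableSet_lt (by fun_prop) measurable_const) measurable_const measurable_const)
    have he : 0 < q / k - 1 := by rw [sub_pos, lt_div_iff₀ hk]; linarith
    rw [lintegral_const_mul _ hmt, setLIntegral_congr_fun measurableSet_Ioi
      (g := fun t => ENNReal.ofReal (t ^ (q - k - 1)) *
        (if ENNReal.ofReal t < (a / ENNReal.ofReal c) ^ k⁻¹ then (1 : ℝ≥0∞) else 0))
      (fun t ht => by simp only [hlt t ht a]), lintegral_rpow_sub_one_mul_ite hqk,
      ← ENNReal.rpow_mul, show k⁻¹ * (q - k) = q / k - 1 by field_simp,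
      ENNReal.div_rpow_of_nonneg _ _ he.le, ENNReal.ofReal_rpow_of_pos hc, div_eq_mul_inv,
      ← ENNReal.ofReal_inv_of_pos (by positivity), ← Real.rpow_neg hc.le]
    have : a ^ (q / k) = a * a ^ (q / k - 1) := by
      conv_rhs => enter [1]; rw [← ENNReal.rpow_one a]
      rw [← ENNReal.rpow_add_of_nonneg _ _ zero_le_one he.le]
      congr 1; ring
    rw [this]
    ring
  rw [lintegral_rpow_eq_lintegral_meas_lt hg hq]
  calc _ ≤ ENNReal.ofReal q * ∫⁻ t in Ioi (0 : ℝ), ENNReal.ofReal c⁻¹ *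
        ∫⁻ y, f y * (ENNReal.ofReal (t ^ (q - k - 1)) *
          (if ENNReal.ofReal (c * t ^ k) < f y then 1 else 0)) ∂ν := by
        gcongr _ * ?_
        exact setLIntegral_mono' measurableSet_Ioi hstep
    _ = ENNReal.ofReal q * (ENNReal.ofReal c⁻¹ * (ENNReal.ofReal (q - k)⁻¹ *
          ENNReal.ofReal (c ^ (-(q / k - 1))) * ∫⁻ y, f y ^ (q / k) ∂ν)) := by
        rw [lintegral_const_mul' _ _ ENNReal.ofReal_ne_top, lintegral_lintegral_swap]
        · simp_rw [hinner]
          rw [lintegral_const_mul _ (by fun_prop)]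
        · refine Measurable.aemeasurable ?_
          exact Measurable.mul (by fun_prop) (Measurable.mul (by fun_prop)
            (Measurable.ite hm measurable_const measurable_const))
    _ = _ := by
        rw [← mul_assoc, ← mul_assoc, ← ENNReal.ofReal_mul (by positivity),
          ← ENNReal.ofReal_mul (by positivity), ← ENNReal.ofReal_mul (by positivity)]
        congr 2
        rw [show -(q / k) = -(q / k - 1) + -1 by ring, Real.rpow_add hc, Real.rpow_neg_one]
        ring

theorem lintegral_rieszPotential_rpow_le {p q : ℝ} (hp1 : 1 < p) (hp2 : p < 2) (hq : 2 < q)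
    (hpq : 1 / q = 1 / p - 1 / 2) :
    ∃ C : ℝ, 0 < C ∧ ∀ f : E2 → ℝ≥0∞, Measurable f → ∫⁻ y, f y ^ p ≤ 1 →
      ∫⁻ x, rieszPotential f x ^ q ≤ ENNReal.ofReal C := by
  obtain ⟨B, hB, hfar⟩ := lintegral_far_mul_le hp1 hp2 hpq
  have hω := measureReal_unit_ball_pos
  set ω := volume.real (Metric.ball (0 : E2) 1)
  set c := (4 * (2 * ω))⁻¹ * (2 * B) ^ (-(q / 2)) with hc_def
  have hc : 0 < c := by positivity
  have hk : 0 < 1 + q / 2 := by positivity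
  have hkq : 1 + q / 2 < q := by linarith
  have hp : q / (1 + q / 2) = p := by
    field_simp at hpq ⊢
    linarith
  have hqk : 0 < q - (1 + q / 2) := by linarith
  refine ⟨q / (q - (1 + q / 2)) * c ^ (-(q / (1 + q / 2))), by positivity, fun f hf hfp => ?_⟩
  refine (lintegral_rpow_le_of_forall_mul_meas_le (measurable_rieszPotential hf) hf hc hk hkq
    fun t ht => ?_).trans (mul_le_of_le_one_right' (by rwa [hp]))
  have h2B : (0 : ℝ) < 2 * B := by positivity
  refine mul_meas_rieszPotential_le hf (R := (2 * B) ^ (q / 2) * t ^ (-(q / 2)))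
    (by positivity) ht ?_ fun x => ?_
  · rw [hc_def, Real.rpow_add ht, Real.rpow_one, Real.rpow_neg h2B.le, Real.rpow_neg ht.le]
    field_simp
    rfl
  · refine (hfar f hf hfp _ (by positivity) x).trans_eq ?_
    rw [Real.mul_rpow (by positivity) (by positivity), ← Real.rpow_mul h2B.le,
      ← Real.rpow_mul ht.le, show q / 2 * -(2 / q) = -1 by field_simp,
      show -(q / 2) * -(2 / q) = 1 by field_simp, Real.rpow_one, Real.rpow_neg_one]
    congr 1; field_simp

theorem rieszPotential_const_mul {a : ℝ≥0∞} (ha : a ≠ ⊤) (f : E2 → ℝ≥0∞) (x : E2) :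
    rieszPotential (fun y => a * f y) x = a * rieszPotential f x := by
  simp only [rieszPotential, mul_left_comm _ a]
  exact lintegral_const_mul' _ _ ha

theorem rieszPotential_congr_ae {f g : E2 → ℝ≥0∞} (h : f =ᵐ[volume] g) :
    rieszPotential f = rieszPotential g :=
  funext fun _ => lintegral_congr_ae (h.mono fun y hy => by simp only [hy])

/-- The Hardy–Littlewood–Sobolev inequality for the Riesz potential of order one on the plane. -/
theorem eLpNorm_rieszPotential_le {p q : ℝ} (hp1 : 1 < p) (hp2 : p < 2) (hq : 2 < q)
    (hpq : 1 / q = 1 / p - 1 / 2) :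
    ∃ C : ℝ, 0 < C ∧ ∀ f : E2 → ℝ≥0∞, AEMeasurable f →
      eLpNorm f (ENNReal.ofReal p) volume ≠ ⊤ →
      eLpNorm (rieszPotential f) (ENNReal.ofReal q) volume ≤
        ENNReal.ofReal C * eLpNorm f (ENNReal.ofReal p) volume := by
  obtain ⟨C, hC, hCf⟩ := lintegral_rieszPotential_rpow_le hp1 hp2 hq hpq
  have hp0 : 0 < p := by linarith
  have hq0 : 0 < q := by linarith
  have hp0' : ENNReal.ofReal p ≠ 0 := by simpa using hp0
  have hq0' : ENNReal.ofReal q ≠ 0 := by simpa using hq0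
  refine ⟨C ^ (1 / q), by positivity, fun f hf' => ?_⟩
  obtain ⟨g, hg, hfg⟩ := hf'
  rw [rieszPotential_congr_ae hfg, eLpNorm_congr_ae hfg]
  intro hfin
  set N := eLpNorm g (ENNReal.ofReal p) volume with hN
  rcases eq_or_ne N 0 with h0 | h0
  · have hg0 : g =ᵐ[volume] 0 := (eLpNorm_eq_zero_iff hg.aestronglyMeasurable hp0').1 h0
    have : rieszPotential g = 0 := by
      rw [rieszPotential_congr_ae hg0]
      ext x
      simp [rieszPotential]
    simp [this]
  · have hNp : ∫⁻ y, g y ^ p = N ^ p := by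
      rw [hN, eLpNorm_eq_lintegral_rpow_enorm_toReal hp0' ENNReal.ofReal_ne_top,
        ENNReal.toReal_ofReal hp0.le, ← ENNReal.rpow_mul, one_div_mul_cancel hp0.ne',
        ENNReal.rpow_one]
      simp
    have hnorm : ∫⁻ y, (N⁻¹ * g y) ^ p ≤ 1 := by
      simp_rw [ENNReal.mul_rpow_of_nonneg _ _ hp0.le]
      rw [lintegral_const_mul _ (by fun_prop), hNp, ← ENNReal.mul_rpow_of_nonneg _ _ hp0.le,
        ENNReal.inv_mul_cancel h0 hfin, ENNReal.one_rpow]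
    have hmain := hCf (fun y => N⁻¹ * g y) (by fun_prop) hnorm
    have hscale : rieszPotential g = fun x => N * rieszPotential (fun y => N⁻¹ * g y) x := by
      ext x
      rw [← rieszPotential_const_mul hfin]
      simp_rw [← mul_assoc, ENNReal.mul_inv_cancel h0 hfin, one_mul]
    rw [eLpNorm_eq_lintegral_rpow_enorm_toReal hq0' ENNReal.ofReal_ne_top,
      ENNReal.toReal_ofReal hq0.le, hscale]
    simp only [enorm_eq_self, ENNReal.mul_rpow_of_nonneg _ _ hq0.le]
    rw [lintegral_const_mul' _ _ (ENNReal.rpow_ne_top_of_nonneg hq0.le hfin)]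
    grw [hmain]
    rw [ENNReal.mul_rpow_of_nonneg _ _ (by positivity), ← ENNReal.rpow_mul,
      mul_one_div_cancel hq0.ne', ENNReal.rpow_one, ENNReal.ofReal_rpow_of_pos hC, mul_comm]

theorem norm_perp (x : E2) : ‖perp x‖ = ‖x‖ := by
  simp [perp, EuclideanSpace.norm_eq, add_comm]

theorem enorm_biotSavart_integrand (w : E2 → ℝ) (x y : E2) :
    ‖((2 * π * ‖x - y‖ ^ 2)⁻¹ * w y) • perp (x - y)‖ₑ =
      ENNReal.ofReal (2 * π)⁻¹ * (ENNReal.ofReal ‖x - y‖⁻¹ * ‖w y‖ₑ) := by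
  rw [← ofReal_norm, ← ofReal_norm, ← ENNReal.ofReal_mul (by positivity),
    ← ENNReal.ofReal_mul (by positivity), norm_smul, norm_perp, norm_mul, Real.norm_of_nonneg
      (by positivity : 0 ≤ (2 * π * ‖x - y‖ ^ 2)⁻¹)]
  congr 1
  rcases eq_or_ne ‖x - y‖ 0 with h | h
  · simp [h]
  · field_simp

theorem lintegral_enorm_biotSavart_integrand (w : E2 → ℝ) (x : E2) :
    ∫⁻ y, ‖((2 * π * ‖x - y‖ ^ 2)⁻¹ * w y) • perp (x - y)‖ₑ =
      ENNReal.ofReal (2 * π)⁻¹ * rieszPotential (fun y => ‖w y‖ₑ) x := by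
  simp_rw [enorm_biotSavart_integrand]
  exact lintegral_const_mul' _ _ ENNReal.ofReal_ne_top

theorem measurable_perp : Measurable perp := by
  apply Continuous.measurable
  unfold perp
  simp only [WithLp.equiv_symm_apply]
  apply (PiLp.continuous_toLp 2 _).comp
  apply continuous_pi
  intro i
  fin_cases i <;> simp <;> fun_prop

/-- Lemma 2.1 (i): the Biot–Savart law maps `L^p` into `L^q` when `1/q = 1/p - 1/2`,
`1 < p < 2 < q < ∞`. -/
theorem biotSavart_Lp_Lq (p q : ℝ) (hp1 : 1 < p) (hp2 : p < 2) (hq : 2 < q)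
    (hpq : 1 / q = 1 / p - 1 / 2) :
    ∃ C : ℝ, 0 < C ∧ ∀ w : E2 → ℝ, MemLp w (ENNReal.ofReal p) volume →
      (∀ᵐ x : E2, Integrable (fun y => ((2 * π * ‖x - y‖ ^ 2)⁻¹ * w y) • perp (x - y)) volume) ∧
      eLpNorm (biotSavart w) (ENNReal.ofReal q) volume
        ≤ ENNReal.ofReal C * eLpNorm w (ENNReal.ofReal p) volume := by
  obtain ⟨C, hC, hCf⟩ := eLpNorm_rieszPotential_le hp1 hp2 hq hpq
  have hq0 : ENNReal.ofReal q ≠ 0 := by simp; linarith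
  refine ⟨(2 * π)⁻¹ * C, by positivity, fun w hw => ?_⟩
  have hle : eLpNorm (rieszPotential fun y => ‖w y‖ₑ) (ENNReal.ofReal q) volume ≤
      ENNReal.ofReal C * eLpNorm w (ENNReal.ofReal p) volume := by
    have h := hCf (fun y => ‖w y‖ₑ) hw.1.enorm
    rw [eLpNorm_enorm] at h
    exact h hw.2.ne
  constructor
  · have hmeas : Measurable (rieszPotential fun y => ‖w y‖ₑ) := by
      obtain ⟨g, hg, hwg⟩ := hw.1.enorm
      rw [rieszPotential_congr_ae hwg]
      exact measurable_rieszPotential hg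
    have hfin := lintegral_rpow_enorm_lt_top_of_eLpNorm_lt_top hq0 ENNReal.ofReal_ne_top
      (hle.trans_lt (ENNReal.mul_lt_top ENNReal.ofReal_lt_top hw.2))
    rw [ENNReal.toReal_ofReal (by linarith)] at hfin
    filter_upwards [ae_lt_top (by fun_prop) hfin.ne] with x hx
    refine ⟨?_, ?_⟩
    · have h1 : Measurable fun y : E2 => (2 * π * ‖x - y‖ ^ 2)⁻¹ := by fun_prop
      have h2 : Measurable fun y : E2 => perp (x - y) := measurable_perp.comp (by fun_prop)
      exact (h1.aestronglyMeasurable.mul hw.1).smul h2.aestronglyMeasurable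
    · rw [HasFiniteIntegral, lintegral_enorm_biotSavart_integrand]
      refine ENNReal.mul_lt_top ENNReal.ofReal_lt_top ?_
      exact (ENNReal.rpow_lt_top_iff_of_pos (by linarith)).1 hx
  · have hpt : ∀ x, ‖biotSavart w x‖ₑ ≤
        ENNReal.ofReal (2 * π)⁻¹ * ‖rieszPotential (fun y => ‖w y‖ₑ) x‖ₑ := fun x =>
      (enorm_integral_le_lintegral_enorm _).trans_eq (lintegral_enorm_biotSavart_integrand w x)
    rw [ENNReal.ofReal_mul (by positivity), mul_assoc]
    grw [← hle]
    exact eLpNorm_le_nnreal_smul_eLpNorm_of_ae_le_mul' (c := Real.toNNReal (2 * π)⁻¹)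
      (.of_forall hpt) _
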